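/- Let p ≥ 1, let α = (α₀, …, α_p) ∈ ℕ^{p+1} be a multiindex with |α| = α₀ + ⋯ + α_p, let ν be a real number with −1 < ν < |α| + p, and define f : (0,∞)^{p+1} → ℂ by f(x₀, …, x_p) := x₀^ν · ∏_{j=0}^p (1 + x_j)^{−α_j−1}. Then for every pair of positive reals 0 < C₁ < C₂ and every multiindex β ∈ ℕ^{p+1}, one has ∫₀^∞ sup_{s ∈ [C₁,C₂]^{p+1}} |u^{|β|} (∂^β f)(u·s)| du < ∞; in particular (β = 0) ∫₀^∞ sup_{s ∈ [C₁,C₂]^{p+1}} |f(u·s)| du < ∞. -/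

import Mathlib

open MeasureTheory

/-- The partial derivative `∂ᵢ` of a function `(Fin q → ℝ) → ℂ`. -/
noncomputable def pderiv' {q : ℕ} (i : Fin q) (g : (Fin q → ℝ) → ℂ) : (Fin q → ℝ) → ℂ :=
  fun x => fderiv ℝ g x (Pi.single i 1)

/-- The iterated partial derivative `∂^β` with multiindex `β`. -/
noncomputable def mderiv' {q : ℕ} (β : Fin q → ℕ) (g : (Fin q → ℝ) → ℂ) : (Fin q → ℝ) → ℂ :=
  ((List.ofFn (fun i : Fin q => (pderiv' i)^[β i])).foldr (· ∘ ·) id) g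

/-- The open positive orthant. -/
def posOrthant (q : ℕ) : Set (Fin q → ℝ) := {x | ∀ j, 0 < x j}

theorem isOpen_posOrthant (q : ℕ) : IsOpen (posOrthant q) := by
  simp only [posOrthant, Set.ofPred_forall]
  exact isOpen_iInter_of_finite fun j => isOpen_lt continuous_const (continuous_apply j)

/-- Homogeneous polynomials of degree `n` in the functions `(c + x_j)⁻¹`, `c ≥ 0`. -/
inductive IsInvPoly {q : ℕ} : ℕ → ((Fin q → ℝ) → ℂ) → Prop
  | const (c : ℂ) : IsInvPoly 0 (fun _ => c)
  | add {n : ℕ} {g h : (Fin q → ℝ) → ℂ} :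
      IsInvPoly n g → IsInvPoly n h → IsInvPoly n (fun x => g x + h x)
  | mul_inv {n : ℕ} {g : (Fin q → ℝ) → ℂ} (c : ℝ) (hc : 0 ≤ c) (j : Fin q) :
      IsInvPoly n g → IsInvPoly (n + 1) (fun x => g x * (((c + x j : ℝ)) : ℂ)⁻¹)

theorem hasFDerivAt_inv_add_coord {q : ℕ} {c : ℝ} (hc : 0 ≤ c) (j : Fin q) {x : Fin q → ℝ}
    (hx : x ∈ posOrthant q) :
    HasFDerivAt (fun x : Fin q → ℝ => (((c + x j : ℝ)) : ℂ)⁻¹)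
      (Complex.ofRealCLM.comp
        ((-((c + x j) ^ 2)⁻¹) • ContinuousLinearMap.proj (R := ℝ) (φ := fun _ : Fin q => ℝ) j)) x := by
  have hne : c + x j ≠ 0 := (add_pos_of_nonneg_of_pos hc (hx j)).ne'
  have h := (hasDerivAt_inv hne).comp_hasFDerivAt x ((hasFDerivAt_apply (𝕜 := ℝ) j x).const_add c)
  have h' := Complex.ofRealCLM.hasFDerivAt.comp x h
  refine h'.congr_of_eventuallyEq (Filter.Eventually.of_forall fun y => ?_)
  simp

theorem pderiv'_inv_add_coord {q : ℕ} {c : ℝ} (hc : 0 ≤ c) (i j : Fin q) {x : Fin q → ℝ}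
    (hx : x ∈ posOrthant q) :
    pderiv' i (fun x : Fin q → ℝ => (((c + x j : ℝ)) : ℂ)⁻¹) x =
      ((-(Pi.single i 1 : Fin q → ℝ) j : ℝ) : ℂ) * (((c + x j : ℝ)) : ℂ)⁻¹ *
        (((c + x j : ℝ)) : ℂ)⁻¹ := by
  rw [pderiv', (hasFDerivAt_inv_add_coord hc j hx).fderiv]
  simp [pow_two]
  ring

theorem pderiv'_mul {q : ℕ} (i : Fin q) {g h : (Fin q → ℝ) → ℂ} {x : Fin q → ℝ}
    (hg : DifferentiableAt ℝ g x) (hh : DifferentiableAt ℝ h x) :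
    pderiv' i (fun x => g x * h x) x = pderiv' i g x * h x + g x * pderiv' i h x := by
  rw [pderiv', fderiv_fun_mul hg hh]
  simp [pderiv']
  ring

theorem pderiv'_congr {q : ℕ} (i : Fin q) {g h : (Fin q → ℝ) → ℂ}
    (hgh : Set.EqOn g h (posOrthant q)) :
    Set.EqOn (pderiv' i g) (pderiv' i h) (posOrthant q) := fun x hx => by
  rw [pderiv', pderiv',
    (hgh.eventuallyEq_of_mem ((isOpen_posOrthant q).mem_nhds hx)).fderiv_eq]

namespace IsInvPoly

variable {q m n : ℕ} {g h : (Fin q → ℝ) → ℂ}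

theorem const_mul (c : ℂ) (hg : IsInvPoly n g) : IsInvPoly n (fun x => c * g x) := by
  induction hg with
  | const d => exact const (c * d)
  | add _ _ ih₁ ih₂ => simpa only [mul_add] using ih₁.add ih₂
  | mul_inv d hd j _ ih => simpa only [mul_assoc] using ih.mul_inv d hd j

theorem mul (hg : IsInvPoly m g) (hh : IsInvPoly n h) :
    IsInvPoly (n + m) (fun x => h x * g x) := by
  induction hg with
  | const c => simpa only [mul_comm, add_zero] using hh.const_mul c
  | add _ _ ih₁ ih₂ => simpa only [mul_add] using ih₁.add ih₂
  | mul_inv d hd j _ ih => simpa only [mul_assoc, add_assoc] using ih.mul_inv d hd j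

theorem inv_add_coord {c : ℝ} (hc : 0 ≤ c) (j : Fin q) :
    IsInvPoly 1 (fun x : Fin q → ℝ => (((c + x j : ℝ)) : ℂ)⁻¹) := by
  simpa using (const (q := q) 1).mul_inv c hc j

theorem zero (n : ℕ) (j : Fin q) : IsInvPoly n (fun _ : Fin q → ℝ => 0) := by
  induction n with
  | zero => exact const 0
  | succ n ih => simpa using ih.mul_inv 0 le_rfl j

theorem differentiableAt (hg : IsInvPoly n g) {x : Fin q → ℝ} (hx : x ∈ posOrthant q) :
    DifferentiableAt ℝ g x := by
  induction hg with
  | const c => exact differentiableAt_const c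
  | add _ _ ih₁ ih₂ => exact ih₁.add ih₂
  | mul_inv c hc j _ ih => exact ih.mul (hasFDerivAt_inv_add_coord hc j hx).differentiableAt

theorem exists_pderiv' (hg : IsInvPoly n g) (i : Fin q) :
    ∃ g', IsInvPoly (n + 1) g' ∧ Set.EqOn (pderiv' i g) g' (posOrthant q) := by
  induction hg with
  | const c => exact ⟨_, zero 1 i, fun x _ => by simp [pderiv']⟩
  | add hg hh ih₁ ih₂ =>
    obtain ⟨g', hg', hgg'⟩ := ih₁
    obtain ⟨h', hh', hhh'⟩ := ih₂
    refine ⟨_, hg'.add hh', fun x hx => ?_⟩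
    rw [← hgg' hx, ← hhh' hx, pderiv', fderiv_fun_add (hg.differentiableAt hx)
      (hh.differentiableAt hx)]
    rfl
  | @mul_inv n g c hc j hg ih =>
    obtain ⟨g', hg', hgg'⟩ := ih
    refine ⟨_, (hg'.mul_inv c hc j).add
      (((hg.const_mul ((-(Pi.single i 1 : Fin q → ℝ) j : ℝ) : ℂ)).mul_inv c hc j).mul_inv c hc j),
      fun x hx => ?_⟩
    rw [pderiv'_mul i (hg.differentiableAt hx) (hasFDerivAt_inv_add_coord hc j hx).differentiableAt,
      pderiv'_inv_add_coord hc i j hx, ← hgg' hx]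
    ring

theorem exists_bound (hg : IsInvPoly n g) {C : ℝ} (hC : 0 < C) :
    ∃ D, 0 ≤ D ∧ ∀ u : ℝ, 0 < u → ∀ s : Fin q → ℝ, (∀ j, C ≤ s j) →
      u ^ n * ‖g (u • s)‖ ≤ D := by
  induction hg with
  | const c => exact ⟨‖c‖, norm_nonneg c, fun u _ s _ => by simp⟩
  | @add n g h _ _ ih₁ ih₂ =>
    obtain ⟨D, hD, hgD⟩ := ih₁
    obtain ⟨E, hE, hhE⟩ := ih₂
    refine ⟨D + E, add_nonneg hD hE, fun u hu s hs => ?_⟩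
    calc u ^ n * ‖g (u • s) + h (u • s)‖ ≤ u ^ n * (‖g (u • s)‖ + ‖h (u • s)‖) := by
          gcongr
          exact norm_add_le _ _
      _ ≤ D + E := by
          rw [mul_add]
          exact add_le_add (hgD u hu s hs) (hhE u hu s hs)
  | @mul_inv n g c hc j _ ih =>
    obtain ⟨D, hD, hgD⟩ := ih
    refine ⟨D * C⁻¹, by positivity, fun u hu s hs => ?_⟩
    have hpos : 0 < c + u * s j := by
      have := hC.trans_le (hs j)
      positivity
    have hfac : u * (c + u * s j)⁻¹ ≤ C⁻¹ := by
      rw [← div_eq_mul_inv, div_le_iff₀ hpos, ← div_eq_inv_mul, le_div_iff₀ hC]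
      nlinarith [mul_le_mul_of_nonneg_left (hs j) hu.le]
    calc u ^ (n + 1) * ‖g (u • s) * (((c + (u • s) j : ℝ)) : ℂ)⁻¹‖
        = (u ^ n * ‖g (u • s)‖) * (u * (c + u * s j)⁻¹) := by
          rw [norm_mul, norm_inv, Complex.norm_real, Pi.smul_apply, smul_eq_mul,
            Real.norm_of_nonneg hpos.le]
          ring
      _ ≤ D * C⁻¹ := mul_le_mul (hgD u hu s hs) hfac (by positivity) hD

end IsInvPoly

/-- On the positive orthant, `f` is differentiable and its logarithmic partial derivatives are
inverse polynomials of degree one. -/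
def HasInvPolyLogDeriv {q : ℕ} (f : (Fin q → ℝ) → ℂ) : Prop :=
  (∀ x ∈ posOrthant q, DifferentiableAt ℝ f x) ∧
    ∀ i, ∃ r, IsInvPoly 1 r ∧ Set.EqOn (pderiv' i f) (fun x => f x * r x) (posOrthant q)

namespace HasInvPolyLogDeriv

variable {q : ℕ} {f g : (Fin q → ℝ) → ℂ}

theorem one : HasInvPolyLogDeriv (fun _ : Fin q → ℝ => (1 : ℂ)) :=
  ⟨fun _ _ => differentiableAt_const _,
    fun i => ⟨_, IsInvPoly.zero 1 i, fun x _ => by simp [pderiv']⟩⟩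

theorem mul (hf : HasInvPolyLogDeriv f) (hg : HasInvPolyLogDeriv g) :
    HasInvPolyLogDeriv (fun x => f x * g x) := by
  refine ⟨fun x hx => (hf.1 x hx).mul (hg.1 x hx), fun i => ?_⟩
  obtain ⟨r, hr, hfr⟩ := hf.2 i
  obtain ⟨t, ht, hgt⟩ := hg.2 i
  refine ⟨_, hr.add ht, fun x hx => ?_⟩
  rw [pderiv'_mul i (hf.1 x hx) (hg.1 x hx), hfr hx, hgt hx]
  ring

theorem pow (hf : HasInvPolyLogDeriv f) (n : ℕ) : HasInvPolyLogDeriv (fun x => f x ^ n) := by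
  induction n with
  | zero => simpa using one
  | succ n ih => simpa only [pow_succ] using ih.mul hf

theorem prod {ι : Type*} (s : Finset ι) {F : ι → (Fin q → ℝ) → ℂ}
    (hF : ∀ k, HasInvPolyLogDeriv (F k)) : HasInvPolyLogDeriv (fun x => ∏ k ∈ s, F k x) := by
  classical
  induction s using Finset.induction_on with
  | empty => simpa using one
  | insert k s hk ih => simpa only [Finset.prod_insert hk] using (hF k).mul ih

theorem inv_add_coord {c : ℝ} (hc : 0 ≤ c) (j : Fin q) :
    HasInvPolyLogDeriv (fun x : Fin q → ℝ => (((c + x j : ℝ)) : ℂ)⁻¹) := by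
  refine ⟨fun x hx => (hasFDerivAt_inv_add_coord hc j hx).differentiableAt, fun i =>
    ⟨_, (IsInvPoly.inv_add_coord hc j).const_mul ((-(Pi.single i 1 : Fin q → ℝ) j : ℝ) : ℂ),
      fun x hx => ?_⟩⟩
  rw [pderiv'_inv_add_coord hc i j hx]
  ring

theorem rpow_coord (ν : ℝ) (j : Fin q) :
    HasInvPolyLogDeriv (fun x : Fin q → ℝ => (((x j) ^ ν : ℝ) : ℂ)) := by
  have key : ∀ x ∈ posOrthant q, HasFDerivAt (fun x : Fin q → ℝ => (((x j) ^ ν : ℝ) : ℂ))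
      (Complex.ofRealCLM.comp ((ν * x j ^ (ν - 1)) •
        ContinuousLinearMap.proj (R := ℝ) (φ := fun _ : Fin q => ℝ) j)) x := fun x hx =>
    Complex.ofRealCLM.hasFDerivAt.comp x
      ((hasFDerivAt_apply (𝕜 := ℝ) j x).rpow_const (Or.inl (hx j).ne'))
  refine ⟨fun x hx => (key x hx).differentiableAt, fun i =>
    ⟨_, (IsInvPoly.inv_add_coord le_rfl j).const_mul
      ((ν * (Pi.single i 1 : Fin q → ℝ) j : ℝ) : ℂ), fun x hx => ?_⟩⟩
  rw [pderiv', (key x hx).fderiv, Real.rpow_sub_one (hx j).ne']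
  simp
  ring

end HasInvPolyLogDeriv

/-- On the positive orthant, `h` is `f` times an inverse polynomial of degree `n`. -/
def IsInvPolyMultiple {q : ℕ} (f : (Fin q → ℝ) → ℂ) (n : ℕ) (h : (Fin q → ℝ) → ℂ) : Prop :=
  ∃ r, IsInvPoly n r ∧ Set.EqOn h (fun x => f x * r x) (posOrthant q)

namespace IsInvPolyMultiple

variable {q n : ℕ} {f h : (Fin q → ℝ) → ℂ}

theorem self (f : (Fin q → ℝ) → ℂ) : IsInvPolyMultiple f 0 f :=
  ⟨_, IsInvPoly.const 1, fun x _ => (mul_one (f x)).symm⟩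

theorem pderiv' (hf : HasInvPolyLogDeriv f) (hh : IsInvPolyMultiple f n h) (i : Fin q) :
    IsInvPolyMultiple f (n + 1) (pderiv' i h) := by
  obtain ⟨r, hr, hhr⟩ := hh
  obtain ⟨t, ht, hft⟩ := hf.2 i
  obtain ⟨r', hr', hrr'⟩ := hr.exists_pderiv' i
  refine ⟨_, (ht.mul hr).add hr', fun x hx => ?_⟩
  rw [pderiv'_congr i hhr hx, pderiv'_mul i (hf.1 x hx) (hr.differentiableAt hx), hft hx, hrr' hx]
  ring

theorem iterate_pderiv' (hf : HasInvPolyLogDeriv f) (hh : IsInvPolyMultiple f n h) (i : Fin q)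
    (k : ℕ) : IsInvPolyMultiple f (n + k) ((_root_.pderiv' i)^[k] h) := by
  induction k with
  | zero => exact hh
  | succ k ih =>
    rw [Function.iterate_succ_apply']
    exact ih.pderiv' hf i

theorem mderiv' (hf : HasInvPolyLogDeriv f) (β : Fin q → ℕ) :
    IsInvPolyMultiple f (∑ i, β i) (mderiv' β f) := by
  have key (L : List (Fin q)) : IsInvPolyMultiple f (L.map β).sum
      ((L.map fun i => (_root_.pderiv' i)^[β i]).foldr (· ∘ ·) id f) := by
    induction L with
    | nil => exact self f
    | cons i L ih =>
      simpa only [List.map_cons, List.sum_cons, List.foldr_cons, Function.comp_apply,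
        add_comm] using ih.iterate_pderiv' hf i (β i)
  rw [Fin.sum_univ_def, _root_.mderiv', List.ofFn_eq_map]
  exact key _

theorem continuousOn (hf : HasInvPolyLogDeriv f) (hh : IsInvPolyMultiple f n h) :
    ContinuousOn h (posOrthant q) := by
  obtain ⟨r, hr, hhr⟩ := hh
  refine ContinuousOn.congr (fun x hx => ?_) hhr
  exact ((hf.1 x hx).continuousAt.mul (hr.differentiableAt hx).continuousAt).continuousWithinAt

end IsInvPolyMultiple

theorem biSup_eq_sSup_image_of_nonneg {X : Type*} {K : Set X} {F : X → ℝ} (hF : ∀ s, 0 ≤ F s)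
    (hK : BddAbove (F '' K)) : ⨆ s ∈ K, F s = sSup (F '' K) := by
  obtain ⟨M, hM⟩ := id hK
  have hS : 0 ≤ sSup (F '' K) := Real.sSup_nonneg (by rintro _ ⟨s, -, rfl⟩; exact hF s)
  have hle : ∀ s, ⨆ _ : s ∈ K, F s ≤ sSup (F '' K) := fun s =>
    Real.iSup_le (fun hs => le_csSup hK ⟨s, hs, rfl⟩) hS
  refine le_antisymm (Real.iSup_le hle hS) (Real.sSup_le ?_ ?_)
  · rintro _ ⟨s, hs, rfl⟩
    have : ⨆ _ : s ∈ K, F s = F s := by simp [hs]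
    exact this ▸ le_ciSup ⟨_, Set.forall_mem_range.2 hle⟩ s
  · exact Real.iSup_nonneg fun s => Real.iSup_nonneg fun _ => hF s

theorem continuousOn_sSup_image {X Y : Type*} [TopologicalSpace X] [TopologicalSpace Y]
    {U : Set X} {K : Set Y} (hK : IsCompact K) {F : X → Y → ℝ}
    (hF : ContinuousOn (Function.uncurry F) (U ×ˢ K)) :
    ContinuousOn (fun u => sSup (F u '' K)) U := by
  rw [continuousOn_iff_continuous_domRestrict]
  have : CompactSpace K := isCompact_iff_compactSpace.1 hK
  have hc : Continuous (fun z : U × K => F z.1 z.2) :=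
    hF.comp_continuous (f := fun z : U × K => ((z.1 : X), (z.2 : Y))) (by fun_prop)
      fun z => ⟨z.1.2, z.2.2⟩
  have := (isCompact_univ (X := K)).continuous_sSup (f := fun (u : U) (s : K) => F u s) hc
  refine this.congr fun u => ?_
  congr 1
  ext y
  simp

theorem integrableOn_biSup_of_le {Y : Type*} [TopologicalSpace Y] {K : Set Y} (hK : IsCompact K)
    {U : Set ℝ} (hU : MeasurableSet U) {F : ℝ → Y → ℝ} (hF0 : ∀ u s, 0 ≤ F u s)
    (hF : ContinuousOn (Function.uncurry F) (U ×ˢ K)) {B : ℝ → ℝ} (hB : IntegrableOn B U)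
    (hB0 : ∀ u ∈ U, 0 ≤ B u) (hFB : ∀ u ∈ U, ∀ s ∈ K, F u s ≤ B u) :
    IntegrableOn (fun u => ⨆ s ∈ K, F u s) U := by
  have heq : Set.EqOn (fun u => ⨆ s ∈ K, F u s) (fun u => sSup (F u '' K)) U := fun u hu =>
    biSup_eq_sSup_image_of_nonneg (hF0 u)
      ⟨B u, by rintro _ ⟨s, hs, rfl⟩; exact hFB u hu s hs⟩
  refine Integrable.mono' hB
    (((continuousOn_sSup_image hK hF).congr heq).aestronglyMeasurable hU) ?_
  refine (ae_restrict_iff' hU).2 (Filter.Eventually.of_forall fun u hu => ?_)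
  rw [Real.norm_of_nonneg (Real.iSup_nonneg fun s => Real.iSup_nonneg fun _ => hF0 u s)]
  exact Real.iSup_le (fun s => Real.iSup_le (fun hs => hFB u hu s hs) (hB0 u hu)) (hB0 u hu)

theorem integrableOn_rpow_mul_inv_one_add_pow {ν : ℝ} {N : ℕ} (hν : -1 < ν) (hN : ν < N - 1) :
    IntegrableOn (fun u : ℝ => u ^ ν * ((1 + u) ^ N)⁻¹) (Set.Ioi 0) := by
  have hmeas : Measurable (fun u : ℝ => u ^ ν * ((1 + u) ^ N)⁻¹) := by fun_prop
  rw [← Set.Ioc_union_Ioi_eq_Ioi zero_le_one, integrableOn_union]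
  constructor
  · have h : IntegrableOn (fun u : ℝ => u ^ ν) (Set.Ioc 0 1) :=
      (intervalIntegrable_iff_integrableOn_Ioc_of_le zero_le_one).1
        (intervalIntegral.intervalIntegrable_rpow' hν)
    refine Integrable.mono' h hmeas.aestronglyMeasurable
      ((ae_restrict_iff' measurableSet_Ioc).2 (Filter.Eventually.of_forall fun u hu => ?_))
    have hu0 : 0 < u := hu.1
    rw [Real.norm_of_nonneg (by positivity)]
    exact mul_le_of_le_one_right (by positivity)
      (inv_le_one_of_one_le₀ (one_le_pow₀ (by linarith)))
  · have h : IntegrableOn (fun u : ℝ => u ^ (ν - N)) (Set.Ioi 1) :=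
      integrableOn_Ioi_rpow_of_lt (by linarith) one_pos
    refine Integrable.mono' h hmeas.aestronglyMeasurable
      ((ae_restrict_iff' measurableSet_Ioi).2 (Filter.Eventually.of_forall fun u hu => ?_))
    have hu0 : 0 < u := one_pos.trans hu
    rw [Real.norm_of_nonneg (by positivity), Real.rpow_sub hu0, Real.rpow_natCast, div_eq_mul_inv]
    gcongr
    linarith

theorem rpow_le_add_of_mem_Icc {a b x : ℝ} (ν : ℝ) (ha : 0 < a) (hx : x ∈ Set.Icc a b) :
    x ^ ν ≤ a ^ ν + b ^ ν := by
  have hx0 : 0 < x := ha.trans_le hx.1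
  have hb0 : 0 < b := hx0.trans_le hx.2
  rcases le_total 0 ν with h | h
  · exact (Real.rpow_le_rpow hx0.le hx.2 h).trans (le_add_of_nonneg_left (by positivity))
  · exact (Real.rpow_le_rpow_of_nonpos ha hx.1 h).trans (le_add_of_nonneg_right (by positivity))

theorem norm_rpow_mul_prod_inv_le {q : ℕ} (i : Fin q) (a : Fin q → ℕ) (ν : ℝ) {C₁ C₂ : ℝ}
    (h1 : 0 < C₁) {u : ℝ} (hu : 0 < u) {s : Fin q → ℝ} (hs : ∀ j, s j ∈ Set.Icc C₁ C₂) :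
    ‖((((u • s) i) ^ ν : ℝ) : ℂ) * ∏ j, ((((1 + (u • s) j : ℝ)) : ℂ) ^ a j)⁻¹‖ ≤
      (C₁ ^ ν + C₂ ^ ν) * (min 1 C₁ ^ (∑ j, a j))⁻¹ * (u ^ ν * ((1 + u) ^ (∑ j, a j))⁻¹) := by
  have hm : 0 < min 1 C₁ := lt_min one_pos h1
  have hs0 : ∀ j, 0 < s j := fun j => h1.trans_le (hs j).1
  have hfac : ∀ j, min 1 C₁ * (1 + u) ≤ 1 + u * s j := fun j => by
    nlinarith [min_le_left 1 C₁, mul_le_mul_of_nonneg_left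
      ((min_le_right 1 C₁).trans (hs j).1) hu.le]
  have hprod : ∏ j, ((1 + u * s j) ^ a j)⁻¹ ≤ ((min 1 C₁ * (1 + u)) ^ (∑ j, a j))⁻¹ := by
    rw [← Finset.prod_pow_eq_pow_sum, ← Finset.prod_inv_distrib]
    refine Finset.prod_le_prod (fun j _ => ?_) fun j _ => ?_
    · have := hs0 j
      positivity
    · have := hfac j
      gcongr
  have hnorm : ∀ j, ‖((((1 + (u • s) j : ℝ)) : ℂ) ^ a j)⁻¹‖ = ((1 + u * s j) ^ a j)⁻¹ := fun j => by
    have := hs0 j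
    rw [norm_inv, norm_pow, Complex.norm_real, Pi.smul_apply, smul_eq_mul,
      Real.norm_of_nonneg (by positivity)]
  rw [norm_mul, norm_prod, Finset.prod_congr rfl fun j _ => hnorm j, Complex.norm_real,
    Pi.smul_apply, smul_eq_mul, Real.mul_rpow hu.le (hs0 i).le,
    Real.norm_of_nonneg (mul_nonneg (by positivity) (Real.rpow_nonneg (hs0 i).le ν))]
  have hnn : 0 ≤ C₁ ^ ν + C₂ ^ ν :=
    (Real.rpow_nonneg (hs0 i).le ν).trans (rpow_le_add_of_mem_Icc ν h1 (hs i))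
  calc u ^ ν * s i ^ ν * ∏ j, ((1 + u * s j) ^ a j)⁻¹
      ≤ u ^ ν * (C₁ ^ ν + C₂ ^ ν) * ((min 1 C₁ * (1 + u)) ^ (∑ j, a j))⁻¹ := by
        refine mul_le_mul (mul_le_mul_of_nonneg_left (rpow_le_add_of_mem_Icc ν h1 (hs i))
          (by positivity)) hprod (Finset.prod_nonneg fun j _ => ?_) (by positivity)
        have := hs0 j
        positivity
    _ = _ := by
        rw [mul_pow, mul_inv]
        ring

/-- For `f(x₀, …, x_p) = x₀^ν ∏_{j=0}^p (1+x_j)^{−α_j−1}` with `−1 < ν < |α| + p`, every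
multiindex `β` and all `0 < C₁ < C₂` one has
`∫₀^∞ sup_{s ∈ [C₁,C₂]^{p+1}} |u^{|β|} (∂^β f)(u·s)| du < ∞` (the case `β = 0` being the
integrability condition for `f` itself).  This verifies the hypotheses of the
Operator Substitution Lemma for the integrand of the Connes–Moscovici Rearrangement Lemma. -/
theorem stmt3 {p : ℕ} (hp : 1 ≤ p) (α : Fin (p+1) → ℕ) (ν : ℝ)
    (hν1 : -1 < ν) (hν2 : ν < ((∑ j, α j : ℕ) : ℝ) + p)
    (f : (Fin (p+1) → ℝ) → ℂ)
    (hfdef : ∀ x, f x = (((x 0) ^ ν : ℝ) : ℂ) * ∏ j, ((((1 + x j : ℝ)) : ℂ) ^ (α j + 1))⁻¹)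
    (β : Fin (p+1) → ℕ) (C₁ C₂ : ℝ) (h1 : 0 < C₁) (h2 : C₁ < C₂) :
    IntegrableOn (fun u : ℝ =>
      ⨆ s ∈ Set.Icc (fun _ : Fin (p+1) => C₁) (fun _ => C₂),
        ‖(u ^ (∑ i, β i) : ℝ) • mderiv' β f (u • s)‖) (Set.Ioi 0) := by
  have hf : HasInvPolyLogDeriv f := by
    rw [funext hfdef]
    simp only [← inv_pow]
    exact (HasInvPolyLogDeriv.rpow_coord ν 0).mul (HasInvPolyLogDeriv.prod _ fun j =>
      (HasInvPolyLogDeriv.inv_add_coord zero_le_one j).pow (α j + 1))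
  have hm := IsInvPolyMultiple.mderiv' hf β
  have hpos : ∀ u ∈ Set.Ioi (0 : ℝ), ∀ s ∈ Set.Icc (fun _ : Fin (p+1) => C₁) (fun _ => C₂),
      u • s ∈ posOrthant (p + 1) := fun u hu s hs j => mul_pos hu (h1.trans_le (hs.1 j))
  have hcont : ContinuousOn (Function.uncurry fun (u : ℝ) (s : Fin (p+1) → ℝ) =>
      ‖(u ^ (∑ i, β i) : ℝ) • mderiv' β f (u • s)‖)
      (Set.Ioi 0 ×ˢ Set.Icc (fun _ : Fin (p+1) => C₁) (fun _ => C₂)) := by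
    have h : ContinuousOn (fun z : ℝ × (Fin (p+1) → ℝ) => mderiv' β f (z.1 • z.2))
        (Set.Ioi 0 ×ˢ Set.Icc (fun _ : Fin (p+1) => C₁) (fun _ => C₂)) :=
      (hm.continuousOn hf).comp (continuous_fst.smul continuous_snd).continuousOn
        fun z hz => hpos z.1 hz.1 z.2 hz.2
    exact ((continuous_fst.pow _).continuousOn.smul h).norm
  obtain ⟨r, hr, hfr⟩ := hm
  obtain ⟨D, hD, hrD⟩ := hr.exists_bound h1
  have hN : ν < ((∑ j, (α j + 1) : ℕ) : ℝ) - 1 := by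
    simp only [Finset.sum_add_distrib]
    push_cast at hν2 ⊢
    simp
    linarith
  have hC₂ : 0 < C₂ := h1.trans h2
  have hmin : 0 < min 1 C₁ := lt_min one_pos h1
  refine integrableOn_biSup_of_le isCompact_Icc measurableSet_Ioi (fun _ _ => norm_nonneg _) hcont
    (((integrableOn_rpow_mul_inv_one_add_pow hν1 hN).const_mul
      ((C₁ ^ ν + C₂ ^ ν) * (min 1 C₁ ^ (∑ j, (α j + 1)))⁻¹)).mul_const D)
    (fun u hu => ?_) fun u hu s hs => ?_
  · have hu : 0 < u := hu
    positivity
  · have hu : 0 < u := hu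
    rw [hfr (hpos u hu s hs), norm_smul, norm_mul, Real.norm_of_nonneg (by positivity),
      mul_left_comm, hfdef]
    exact mul_le_mul (norm_rpow_mul_prod_inv_le 0 (fun j => α j + 1) ν h1 hu
      fun j => ⟨hs.1 j, hs.2 j⟩) (hrD u hu s hs.1) (by positivity) (by positivity)
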